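/- Let M > 0 and let ψ : (M,∞) → ℝ be a positive (weakly) increasing function such that ∫_M^∞ ψ(λ)·e^{-ψ(λ)²/2} dλ/λ < ∞. Then there exists a nonnegative integrable function π̃ on (0,1) such that for every sequence x : ℕ → ℝ with x_i ≥ -1 for all i: if Σ_{i=1}^∞ x_i² = ∞ and S_n > A_n·ψ(A_n²) for infinitely many n, then limsup_{n→∞} ∫_0^1 ∏_{i=1}^n (1 + ε x_i) π̃(ε) dε = ∞. -/

import Mathlib

open MeasureTheory Filter Set

/-- Partial sum `S_n = x_1 + ... + x_n`. -/
noncomputable def S (x : ℕ → ℝ) (n : ℕ) : ℝ := ∑ i ∈ Finset.range n, x i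

/-- Sum of squares `A_n² = x_1² + ... + x_n²`. -/
noncomputable def A2 (x : ℕ → ℝ) (n : ℕ) : ℝ := ∑ i ∈ Finset.range n, (x i) ^ 2

/-- Capital process of the Bayesian strategy with prior density `π`:
`K_n^π = ∫_0^1 ∏_{i=1}^n (1 + ε x_i) π(ε) dε`. -/
noncomputable def K (π : ℝ → ℝ) (x : ℕ → ℝ) (n : ℕ) : ℝ :=
  ∫ ε in Set.Ioo (0 : ℝ) 1, (∏ i ∈ Finset.range n, (1 + ε * x i)) * π ε

/-- Assumption 1: `π` is a prior density, bounded below by `δπ` near the origin,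
and `ε ↦ ε·π(ε)` is (weakly) increasing near the origin. -/
def Assumption1 (π : ℝ → ℝ) (επ δπ : ℝ) : Prop :=
  επ ∈ Set.Ioo (0 : ℝ) 1 ∧ 0 < δπ ∧
  (∀ ε ∈ Set.Icc (0 : ℝ) 1, 0 ≤ π ε) ∧
  MeasureTheory.IntegrableOn π (Set.Icc (0 : ℝ) 1) ∧
  (∀ ε ∈ Set.Ioo (0 : ℝ) επ, δπ ≤ π ε) ∧
  MonotoneOn (fun ε => ε * π ε) (Set.Ioo (0 : ℝ) επ)


lemma one_step (e x : ℝ) (he : 0 ≤ e) (he2 : e ≤ 1/2) (hx : -1 ≤ x) :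
    Real.exp (e * x - e^2 * x^2 / 2 - 2 * e^3 * x^2) ≤ 1 + e * x := by
  have hp : 0 < 1 + e * x := by nlinarith
  rw [← Real.le_log_iff_exp_le hp]
  have h3 : 0 ≤ e^3 * x^2 := by positivity
  rcases le_or_gt 0 x with h | h
  · have ht : 0 ≤ e * x := mul_nonneg he h
    have := Real.le_log_one_add_of_nonneg ht
    have h2 : e * x - e^2 * x^2 / 2 ≤ 2 * (e * x) / (e * x + 2) := by
      rw [le_div_iff₀ (by positivity)]
      nlinarith [pow_nonneg ht 3]
    linarith
  · set s := e * (-x) with hs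
    have hs0 : 0 ≤ s := mul_nonneg he (by linarith)
    have hs1 : s ≤ 1/2 := by nlinarith
    have := Real.abs_log_sub_add_sum_range_le (x := s) (by rw [abs_of_nonneg hs0]; linarith) 2
    rw [abs_of_nonneg hs0] at this
    have h4 : s ^ (2+1) / (1 - s) ≤ 2 * e^3 * x^2 := by
      rw [div_le_iff₀ (by linarith)]
      have h5 : s^3 ≤ e^3 * x^2 := by
        have : s^3 = e^3 * x^2 * (-x) := by rw [hs]; ring
        rw [this]; nlinarith
      have : s^(2+1) = s^3 := by norm_num
      rw [this]; nlinarith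
    have h6 := (abs_le.1 (this.trans h4)).1
    simp [Finset.sum_range_succ] at h6
    have : 1 + e * x = 1 - s := by rw [hs]; ring
    rw [this]
    have : e * x = - s := by rw [hs]; ring
    have h7: e^2 * x^2 = s^2 := by rw [hs]; ring
    rw [h7, this]; linarith

lemma prod_lower (x : ℕ → ℝ) (hx : ∀ i, -1 ≤ x i) (e : ℝ) (he : 0 ≤ e) (he2 : e ≤ 1/2) (n : ℕ) :
    Real.exp (e * (∑ i ∈ Finset.range n, x i) - e^2 * (∑ i ∈ Finset.range n, (x i)^2) / 2
      - 2 * e^3 * (∑ i ∈ Finset.range n, (x i)^2)) ≤ ∏ i ∈ Finset.range n, (1 + e * x i) := by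
  have : e * (∑ i ∈ Finset.range n, x i) - e^2 * (∑ i ∈ Finset.range n, (x i)^2) / 2
      - 2 * e^3 * (∑ i ∈ Finset.range n, (x i)^2)
      = ∑ i ∈ Finset.range n, (e * x i - e^2 * (x i)^2 / 2 - 2 * e^3 * (x i)^2) := by
    rw [Finset.sum_sub_distrib, Finset.sum_sub_distrib, Finset.mul_sum, Finset.mul_sum,
      Finset.mul_sum, Finset.sum_div]
  rw [this, Real.exp_sum]
  exact Finset.prod_le_prod (fun i _ => (Real.exp_pos _).le) (fun i _ => one_step e _ he he2 (hx i))

lemma pow3_le_sqrt (l t : ℝ) (h : l^6 ≤ t) : l^3 ≤ √t := by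
  apply Real.le_sqrt_of_sq_le
  calc _ = l^6 := by ring
    _ ≤ t := h

lemma eps_le (l t e : ℝ) (hl : 2 ≤ l) (h : l^6 ≤ t) (he : e * √t ≤ l + 1) : e ≤ 1/2 := by
  have h1 := pow3_le_sqrt l t h
  have h2 : l + 1 ≤ l^3/2 := by nlinarith [mul_nonneg (sub_nonneg.2 hl) (sub_nonneg.2 hl)]
  have h3 : 0 < √t := by nlinarith
  by_contra hc
  nlinarith

lemma scalar_key (y l a t e s : ℝ) (hl : 2 ≤ l) (hly : l ≤ y) (hya : y^6 ≤ a)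
    (ht1 : a * (1 - 1/y) ≤ t) (ht2 : t ≤ a) (he1 : l ≤ e * √t) (he2 : e * √t ≤ l + 1)
    (hs : √a * y < s) :
    l^2/2 + (y - l) - 40 ≤ e * s - e^2 * a / 2 - 2 * e^3 * a := by
  have hy : 2 ≤ y := hl.trans hly
  have ha : 0 < a := lt_of_lt_of_le (by positivity) hya
  have hra : y^3 ≤ √a := pow3_le_sqrt y a hya
  have hy3 : 0 < y^3 := by positivity
  have hsa : 0 < √a := by linarith
  have he : 0 < e := by
    by_contra hc
    have := Real.sqrt_nonneg t
    nlinarith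
  have hu : 0 < 1/y := by positivity
  have huy : 1/y * y = 1 := by field_simp
  have hu2 : 1/y ≤ 1/2 := by rw [div_le_div_iff₀ (by linarith) (by norm_num)]; linarith
  set u := 1/y with hudef
  have ht0 : 0 ≤ t := le_trans (by nlinarith) ht1
  have h1 : √a ≤ √t * (1 + u) := by
    rw [Real.sqrt_le_left (by positivity)]
    rw [mul_pow, Real.sq_sqrt ht0]
    have h5 : 1 ≤ (1 - u) * (1+u)^2 := by nlinarith [mul_nonneg hu.le (sub_nonneg.2 hu2), mul_nonneg hu.le (mul_nonneg hu.le (sub_nonneg.2 hu2))]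
    calc a ≤ a * ((1 - u) * (1+u)^2) := by nlinarith
      _ = a * (1-u) * (1+u)^2 := by ring
      _ ≤ _ := by gcongr
  have h2 : √t ≤ √a := Real.sqrt_le_sqrt ht2
  have hp1 : l ≤ e * √a := he1.trans (by gcongr)
  have hp2 : e * √a ≤ l + 3 := by
    calc e * √a ≤ e * (√t * (1+u)) := by gcongr
      _ = (e * √t) * (1+u) := by ring
      _ ≤ (l+1) * (1+u) := by gcongr
      _ ≤ l + 3 := by nlinarith
  have hsq : √a * √a = a := Real.mul_self_sqrt ha.le
  have e2 : e^2 * a = (e * √a)^2 := by rw [mul_pow, sq (√a), hsq]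
  have e3 : e^3 * a * √a = (e * √a)^3 := by
    calc e^3 * a * √a = e^3 * (√a * √a) * √a := by rw [hsq]
      _ = _ := by ring
  have h3 : e * √a * y ≤ e * s := by nlinarith
  set p := e * √a with hp
  have h4 : e^3 * a ≤ 16 := by
    have h41 : p^3 ≤ 16 * y^3 := by
      calc p^3 ≤ (5/2 * y)^3 := by gcongr; linarith
        _ = (125/8) * y^3 := by ring
        _ ≤ _ := by nlinarith
    have : e^3 * a * √a ≤ 16 * √a := by rw [e3]; linarith
    exact le_of_mul_le_mul_right this hsa
  rw [e2]
  obtain ⟨v, hv⟩ : ∃ v, v = p - l := ⟨_, rfl⟩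
  have hpv : p = l + v := by linarith
  have hv0 : 0 ≤ v := by linarith
  have hv3 : v ≤ 3 := by linarith
  rw [hpv] at h3 ⊢
  nlinarith [mul_nonneg hv0 (sub_nonneg.2 hly), mul_nonneg (sub_nonneg.2 hl) (sub_nonneg.2 hly)]

lemma le_mul_exp (y l : ℝ) (hl : 2 ≤ l) (hly : l ≤ y) : y ≤ l * Real.exp (y - l) := by
  have := Real.add_one_le_exp (y - l)
  nlinarith

lemma exists_weight (w : ℝ → ENNReal) (hw : Measurable w) (hf : ∫⁻ t, w t ≠ ⊤) :
    ∃ h : ℝ → ENNReal, Measurable h ∧ ∫⁻ t, w t * h t ≠ ⊤ ∧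
      ∀ m : ℕ, ∃ N : ℝ, ∀ t, N < t → (m : ENNReal) ≤ h t := by
  have hk : ∀ k : ℕ, ∃ N : ℝ, ∫⁻ t, w t * (Ioi N).indicator 1 t ≤ (1/2 : ENNReal)^k := by
    intro k
    have hlim : Tendsto (fun n : ℕ => ∫⁻ t, w t * (Ioi (n:ℝ)).indicator 1 t) atTop
        (nhds (∫⁻ _ : ℝ, 0)) := by
      apply tendsto_lintegral_of_dominated_convergence w
      · intro n
        exact hw.mul (measurable_one.indicator measurableSet_Ioi)
      · intro n
        refine Eventually.of_forall fun t => ?_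
        by_cases h : t ∈ Ioi (n:ℝ) <;> simp [h]
      · exact hf
      · refine Eventually.of_forall fun t => ?_
        apply tendsto_const_nhds.congr'
        obtain ⟨n0, hn0⟩ := exists_nat_ge t
        filter_upwards [eventually_ge_atTop n0] with n hn
        have : t ∉ Ioi (n:ℝ) := by
          simp only [mem_Ioi, not_lt]
          exact hn0.trans (by exact_mod_cast hn)
        simp only [indicator_of_notMem this, mul_zero]
    rw [lintegral_zero] at hlim
    have hpos : (0:ENNReal) < (1/2)^k := by
      apply ENNReal.pow_pos
      simp
    obtain ⟨n, hn⟩ := (hlim.eventually (eventually_lt_nhds hpos)).exists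
    exact ⟨n, hn.le⟩
  choose N hN using hk
  refine ⟨fun t => ∑' k, (Ioi (N k)).indicator 1 t, ?_, ?_, ?_⟩
  · exact Measurable.tsum fun k => measurable_one.indicator measurableSet_Ioi
  · have : ∫⁻ t, w t * ∑' k, (Ioi (N k)).indicator 1 t ≤ ∑' k : ℕ, (1/2 : ENNReal)^k := by
      simp_rw [← ENNReal.tsum_mul_left]
      rw [lintegral_tsum]
      · exact ENNReal.tsum_le_tsum hN
      · intro k
        exact (hw.mul (measurable_one.indicator measurableSet_Ioi)).aemeasurable
    refine ne_top_of_le_ne_top ?_ this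
    rw [ENNReal.tsum_geometric]
    simp
  · intro m
    obtain ⟨B, hB⟩ : ∃ B : ℝ, ∀ k ∈ Finset.range m, N k ≤ B :=
      ⟨∑ k ∈ Finset.range m, |N k|, fun k hk => (le_abs_self _).trans
        (Finset.single_le_sum (f := fun k => |N k|) (fun i _ => abs_nonneg _) hk)⟩
    refine ⟨B, fun t ht => ?_⟩
    calc (m : ENNReal) = ∑ k ∈ Finset.range m, (Ioi (N k)).indicator (1 : ℝ → ENNReal) t := by
          rw [Finset.sum_congr rfl (g := fun _ => (1 : ENNReal))]
          · simp
          · intro k hk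
            exact indicator_of_mem (show N k < t from (hB k hk).trans_lt ht) _
      _ ≤ _ := ENNReal.sum_le_tsum _

/-- The kernel: uniform distribution on `[φ(t)/√t, (φ(t)+1)/√t]`. -/
noncomputable def kern (φ : ℝ → ℝ) (t e : ℝ) : ENNReal :=
  ENNReal.ofReal (√t) * {p : ℝ × ℝ | φ p.1 ≤ p.2 * √p.1 ∧ p.2 * √p.1 ≤ φ p.1 + 1}.indicator 1 (t, e)

lemma kern_meas (φ : ℝ → ℝ) (hφ : Measurable φ) :
    Measurable (Function.uncurry (kern φ)) := by
  unfold kern Function.uncurry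
  apply Measurable.mul
  · fun_prop
  · refine (measurable_one.indicator ?_).comp (by fun_prop)
    have h1 : Measurable fun p : ℝ × ℝ => φ p.1 := by fun_prop
    have h2 : Measurable fun p : ℝ × ℝ => p.2 * √p.1 := by fun_prop
    exact (measurableSet_le h1 h2).inter (measurableSet_le h2 (h1.add_const 1))

lemma kern_eq (φ : ℝ → ℝ) (t : ℝ) (ht : 0 < t) (e : ℝ) :
    kern φ t e = (Icc (φ t / √t) ((φ t + 1)/√t)).indicator (fun _ => ENNReal.ofReal (√t)) e := by
  have hs : 0 < √t := Real.sqrt_pos.2 ht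
  unfold kern
  by_cases h : e ∈ Icc (φ t / √t) ((φ t + 1)/√t)
  · rw [indicator_of_mem h, indicator_of_mem]
    · simp
    · rw [mem_Icc, div_le_iff₀ hs, le_div_iff₀ hs] at h
      exact h
  · rw [indicator_of_notMem h, indicator_of_notMem]
    · simp
    · rw [mem_Icc, div_le_iff₀ hs, le_div_iff₀ hs] at h
      exact h

lemma kern_mass (φ : ℝ → ℝ) (t : ℝ) (ht : 0 < t) : ∫⁻ e, kern φ t e = 1 := by
  have hs : 0 < √t := Real.sqrt_pos.2 ht
  simp_rw [kern_eq φ t ht]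
  rw [lintegral_indicator measurableSet_Icc, lintegral_const, Measure.restrict_apply_univ,
    Real.volume_Icc, ← ENNReal.ofReal_mul hs.le]
  rw [← ENNReal.ofReal_one]
  congr 1
  field_simp
  ring

lemma core (φ : ℝ → ℝ) (L : ℝ) (hmono : Monotone φ) (h2 : ∀ t, 2 ≤ φ t) (hL : 0 ≤ L)
    (h6 : ∀ t, L < t → φ t ^ 6 ≤ t)
    (hint : IntegrableOn (fun l => φ l * Real.exp (-(φ l) ^ 2 / 2) / l) (Ioi L)) :
    ∃ πt : ℝ → ℝ, (∀ ε ∈ Set.Ioo (0 : ℝ) 1, 0 ≤ πt ε) ∧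
      MeasureTheory.IntegrableOn πt (Set.Ioo (0 : ℝ) 1) ∧
      ∀ x : ℕ → ℝ, (∀ i, -1 ≤ x i) →
        Filter.Tendsto (A2 x) Filter.atTop Filter.atTop →
        (∃ᶠ n in Filter.atTop, Real.sqrt (A2 x n) * φ (A2 x n) < S x n) →
        Filter.limsup (fun n => ((K πt x n : ℝ) : EReal)) Filter.atTop = ⊤ := by
  have hφm : Measurable φ := hmono.measurable
  let w : ℝ → ENNReal :=
    (Ioi L).indicator (fun l => ENNReal.ofReal (φ l * Real.exp (-(φ l) ^ 2 / 2) / l))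
  have hw : Measurable w := by
    apply Measurable.indicator _ measurableSet_Ioi
    fun_prop
  have hwf : ∫⁻ t, w t ≠ ⊤ := by
    rw [lintegral_indicator measurableSet_Ioi]
    exact hint.lintegral_lt_top.ne
  obtain ⟨h, hh, hwh, hN⟩ := exists_weight w hw hwf
  let G : ℝ → ENNReal := fun e => ∫⁻ t, w t * h t * kern φ t e
  have hkm := kern_meas φ hφm
  have hGm : Measurable G := by
    apply Measurable.lintegral_prod_left (f := fun t e : ℝ => w t * h t * kern φ t e)
    exact ((hw.comp measurable_fst).mul (hh.comp measurable_fst)).mul hkm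
  have hswap : ∀ P : ℝ → ENNReal, Measurable P → ∫⁻ e in Ioo (0:ℝ) 1, P e * G e
      = ∫⁻ t, w t * h t * ∫⁻ e in Ioo (0:ℝ) 1, P e * kern φ t e := by
    intro P hP
    have : ∀ e, P e * G e = ∫⁻ t, w t * h t * (P e * kern φ t e) := by
      intro e
      rw [← lintegral_const_mul]
      · congr 1; ext t; ring
      · exact (hw.mul hh).mul (hkm.comp (by fun_prop : Measurable fun t : ℝ => (t, e)))
    simp_rw [this]
    rw [lintegral_lintegral_swap]
    · congr 1; ext t
      rw [lintegral_const_mul]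
      exact hP.mul (hkm.comp (by fun_prop : Measurable fun e : ℝ => (t, e)))
    · apply Measurable.aemeasurable
      exact ((hw.comp measurable_snd).mul (hh.comp measurable_snd)).mul
        ((hP.comp measurable_fst).mul (hkm.comp measurable_swap))
  have hGf : ∫⁻ e in Ioo (0:ℝ) 1, G e ≠ ⊤ := by
    have := hswap (fun _ => 1) measurable_const
    simp only [one_mul] at this
    rw [this]
    refine ne_top_of_le_ne_top hwh (lintegral_mono fun t => ?_)
    by_cases ht : t ∈ Ioi L
    · calc _ ≤ w t * h t * ∫⁻ e, kern φ t e := by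
            gcongr; exact Measure.restrict_le_self
        _ = _ := by rw [kern_mass φ t (lt_of_le_of_lt hL ht), mul_one]
    · simp [w, indicator_of_notMem ht]
  have hGi : IntegrableOn (fun e => (G e).toReal) (Ioo (0:ℝ) 1) :=
    integrable_toReal_of_lintegral_ne_top hGm.aemeasurable hGf
  have hGae : ∀ᵐ e ∂(volume.restrict (Ioo (0:ℝ) 1)), G e < ⊤ := ae_lt_top hGm hGf
  refine ⟨fun e => (G e).toReal, fun _ _ => ENNReal.toReal_nonneg, hGi, ?_⟩
  intro x hx hA hfreq
  -- convert K
  have hK : ∀ n, ENNReal.ofReal (K (fun e => (G e).toReal) x n) =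
      ∫⁻ e in Ioo (0:ℝ) 1, ENNReal.ofReal (∏ i ∈ Finset.range n, (1 + e * x i)) * G e := by
    intro n
    unfold K
    have hPnn : ∀ e ∈ Ioo (0:ℝ) 1, 0 ≤ ∏ i ∈ Finset.range n, (1 + e * x i) := by
      intro e he
      refine Finset.prod_nonneg fun i _ => ?_
      nlinarith [hx i, he.1, he.2]
    rw [ofReal_integral_eq_lintegral_ofReal]
    · apply lintegral_congr_ae
      filter_upwards [hGae, ae_restrict_mem measurableSet_Ioo] with e he hm
      rw [ENNReal.ofReal_mul (hPnn e hm), ENNReal.ofReal_toReal he.ne]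
    · exact IntegrableOn.continuousOn_mul_of_subset (K := Icc 0 1) (by fun_prop) hGi isCompact_Icc
        measurableSet_Ioo Ioo_subset_Icc_self
    · filter_upwards [ae_restrict_mem measurableSet_Ioo] with e hm
      exact mul_nonneg (hPnn e hm) ENNReal.toReal_nonneg
  have main : ∀ m : ℕ, ∃ᶠ n in atTop, (m : ℝ) * Real.exp (-40) ≤ K (fun e => (G e).toReal) x n := by
    intro m
    obtain ⟨N, hNm⟩ := hN m
    have hev := hA.eventually_gt_atTop (2 * max N L)
    refine (hfreq.and_eventually hev).mono ?_
    rintro n ⟨hS, ha⟩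
    set a := A2 x n with hadef
    set y := φ a with hydef
    have hy : 2 ≤ y := h2 a
    have haN : 2 * N < a := lt_of_le_of_lt (by linarith [le_max_left N L]) ha
    have haL : 2 * L < a := lt_of_le_of_lt (by linarith [le_max_right N L]) ha
    have ha0 : 0 < a := by linarith
    have hya : y^6 ≤ a := h6 a (by linarith)
    have hu2 : 1/y ≤ 1/2 := by rw [div_le_div_iff₀ (by linarith) (by norm_num)]; linarith
    by_cases hm0 : m = 0
    · subst hm0
      simp only [Nat.cast_zero, zero_mul]
      unfold K
      refine setIntegral_nonneg measurableSet_Ioo fun e he => ?_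
      refine mul_nonneg (Finset.prod_nonneg fun i _ => ?_) ENNReal.toReal_nonneg
      nlinarith [hx i, he.1, he.2]
    suffices hsuf : ENNReal.ofReal (m * Real.exp (-40)) ≤
        ENNReal.ofReal (K (fun e => (G e).toReal) x n) by
      rw [ENNReal.ofReal_le_ofReal_iff'] at hsuf
      rcases hsuf with h | h
      · exact h
      · have : 0 < (m:ℝ) * Real.exp (-40) := by positivity
        linarith
    rw [hK n, hswap _ (by fun_prop)]
    have hpt : ∀ t ∈ Ioo (a * (1 - 1/y)) a, (m : ENNReal) * ENNReal.ofReal (Real.exp (-40) * y / a) ≤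
        w t * h t * ∫⁻ e in Ioo (0:ℝ) 1,
          ENNReal.ofReal (∏ i ∈ Finset.range n, (1 + e * x i)) * kern φ t e := by
      intro t ht
      have hta : a / 2 < t := lt_of_le_of_lt (by nlinarith) ht.1
      have htL : L < t := by linarith
      have ht0 : 0 < t := by linarith
      have hs : 0 < √t := Real.sqrt_pos.2 ht0
      set l := φ t with hldef
      have hl : 2 ≤ l := h2 t
      have hly : l ≤ y := hmono ht.2.le
      have hlt : l^6 ≤ t := h6 t htL
      have hinner : ENNReal.ofReal (Real.exp (l^2/2 + (y-l) - 40)) ≤ ∫⁻ e in Ioo (0:ℝ) 1,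
          ENNReal.ofReal (∏ i ∈ Finset.range n, (1 + e * x i)) * kern φ t e := by
        have hsub : ∀ e, kern φ t e ≠ 0 → (l ≤ e * √t ∧ e * √t ≤ l + 1) := by
          intro e he
          rw [kern_eq φ t ht0] at he
          have := mem_of_indicator_ne_zero he
          rw [mem_Icc, div_le_iff₀ hs, le_div_iff₀ hs] at this
          exact this
        rw [← lintegral_indicator measurableSet_Ioo]
        calc ENNReal.ofReal (Real.exp (l^2/2 + (y-l) - 40))
            = ∫⁻ e, ENNReal.ofReal (Real.exp (l^2/2 + (y-l) - 40)) * kern φ t e := by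
              rw [lintegral_const_mul, kern_mass φ t ht0, mul_one]
              exact hkm.comp (by fun_prop : Measurable fun e : ℝ => (t, e))
          _ ≤ _ := by
              refine lintegral_mono fun e => ?_
              by_cases hz : kern φ t e = 0
              · simp [hz]
              obtain ⟨he1, he2⟩ := hsub e hz
              have heh : e ≤ 1/2 := eps_le l t e hl hlt he2
              have he0 : 0 < e := by
                by_contra hc
                nlinarith
              rw [indicator_of_mem (show e ∈ Ioo (0:ℝ) 1 from ⟨he0, by linarith⟩)]
              gcongr
              refine le_trans ?_ (prod_lower x hx e he0.le heh n)
              exact Real.exp_le_exp.2 (scalar_key y l a t e (S x n) hl hly hya ht.1.le ht.2.le he1 he2 hS)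
      have hwt : w t = ENNReal.ofReal (l * Real.exp (-l ^ 2 / 2) / t) := indicator_of_mem htL _
      calc (m : ENNReal) * ENNReal.ofReal (Real.exp (-40) * y / a)
          ≤ h t * ENNReal.ofReal (l * Real.exp (-l ^ 2 / 2) / t * Real.exp (l^2/2 + (y-l) - 40)) := by
            gcongr
            · exact hNm t (by linarith)
            · have e1 : l * Real.exp (-l ^ 2 / 2) / t * Real.exp (l^2/2 + (y-l) - 40)
                  = Real.exp (-40) * (l * Real.exp (y - l)) / t := by
                have : Real.exp (l^2/2 + (y-l) - 40) =
                    Real.exp (-40) * Real.exp (y-l) * Real.exp (l^2/2) := by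
                  rw [← Real.exp_add, ← Real.exp_add]; ring_nf
                have h' : Real.exp (-l^2/2) * Real.exp (l^2/2) = 1 := by
                  rw [← Real.exp_add, ← Real.exp_zero]; ring_nf
                rw [this]
                calc _ = Real.exp (-40) * (l * Real.exp (y - l)) / t *
                      (Real.exp (-l^2/2) * Real.exp (l^2/2)) := by ring
                  _ = _ := by rw [h', mul_one]
              rw [e1]
              have := le_mul_exp y l hl hly
              have := ht.2.le
              gcongr
        _ = w t * h t * ENNReal.ofReal (Real.exp (l^2/2 + (y-l) - 40)) := by
            rw [hwt, ENNReal.ofReal_mul (by positivity)]; ring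
        _ ≤ _ := by gcongr
    calc ENNReal.ofReal (m * Real.exp (-40))
        = ∫⁻ t in Ioo (a * (1 - 1/y)) a, (m : ENNReal) * ENNReal.ofReal (Real.exp (-40) * y / a) := by
          rw [lintegral_const, Measure.restrict_apply_univ, Real.volume_Ioo,
            ← ENNReal.ofReal_natCast m, ← ENNReal.ofReal_mul (by positivity),
            ← ENNReal.ofReal_mul (by positivity)]
          congr 1
          field_simp
          ring
      _ ≤ ∫⁻ t in Ioo (a * (1 - 1/y)) a, w t * h t * ∫⁻ e in Ioo (0:ℝ) 1,
          ENNReal.ofReal (∏ i ∈ Finset.range n, (1 + e * x i)) * kern φ t e :=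
          setLIntegral_mono' measurableSet_Ioo hpt
      _ ≤ _ := setLIntegral_le_lintegral _ _
  rw [EReal.eq_top_iff_forall_lt]
  intro r
  obtain ⟨m, hm⟩ := exists_nat_gt (r / Real.exp (-40))
  rw [div_lt_iff₀ (Real.exp_pos _)] at hm
  refine lt_of_lt_of_le (b := (((m : ℝ) * Real.exp (-40) : ℝ) : EReal)) (by exact_mod_cast hm) ?_
  apply le_limsup_of_frequently_le
  · exact (main m).mono fun n hn => by exact_mod_cast hn
  · isBoundedDefault

lemma f_tail (t : ℝ) (ht : 1 ≤ t) : t * Real.exp (-t^2/2) ≤ 384 / t^6 := by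
  have h := Real.pow_div_factorial_le_exp (t^2/2) (by positivity) 4
  have h0 : -t^2/2 = -(t^2/2) := by ring
  rw [h0, Real.exp_neg, ← div_eq_mul_inv, div_le_div_iff₀ (Real.exp_pos _) (by positivity)]
  have h1 : (t^2/2)^4 / (Nat.factorial 4 : ℝ) = t^8/384 := by
    norm_num [Nat.factorial]; ring
  rw [h1] at h
  have : t * t^6 ≤ t^8 := by
    have : 0 ≤ t^7 := by positivity
    nlinarith
  linarith

lemma exists_ge_two (M : ℝ) (hM : 0 < M) (ψ : ℝ → ℝ)
    (hpos : ∀ l ∈ Set.Ioi M, 0 < ψ l)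
    (hmono : MonotoneOn ψ (Set.Ioi M))
    (hint : MeasureTheory.IntegrableOn
      (fun l => ψ l * Real.exp (-(ψ l) ^ 2 / 2) / l) (Set.Ioi M)) :
    ∃ L, M < L ∧ 2 ≤ ψ L := by
  by_contra hc
  push Not at hc
  have hc1 : 0 < ψ (M+1) := hpos _ (by simp)
  set c := ψ (M+1) * Real.exp (-2) with hcdef
  have hcpos : 0 < c := by positivity
  have h1 : IntegrableOn (fun l : ℝ => c⁻¹ * (ψ l * Real.exp (-(ψ l) ^ 2 / 2) / l)) (Ioi (M+1)) :=
    (hint.mono_set (Ioi_subset_Ioi (by linarith))).const_mul _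
  have h2 : IntegrableOn (·⁻¹) (Ioi (M+1)) := by
    refine Integrable.mono' h1 measurable_inv.aestronglyMeasurable ?_
    filter_upwards [ae_restrict_mem measurableSet_Ioi] with l hl
    have hl' : M + 1 < l := hl
    have hl0 : 0 < l := by linarith
    rw [Real.norm_of_nonneg (by positivity)]
    have e1 : ψ (M+1) ≤ ψ l := hmono (by simp) (show M < l by linarith) hl'.le
    have e2 : ψ l < 2 := hc l (by linarith)
    have e3 : c ≤ ψ l * Real.exp (-(ψ l)^2/2) := by
      rw [hcdef]
      have := hc1.trans_le e1
      gcongr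
      nlinarith
    calc l⁻¹ = c⁻¹ * (c / l) := by field_simp
      _ ≤ _ := by gcongr
  exact not_integrableOn_Ioi_inv h2

theorem efkp_validity (M : ℝ) (hM : 0 < M) (ψ : ℝ → ℝ)
    (hpos : ∀ l ∈ Set.Ioi M, 0 < ψ l)
    (hmono : MonotoneOn ψ (Set.Ioi M))
    (hint : MeasureTheory.IntegrableOn
      (fun l => ψ l * Real.exp (-(ψ l) ^ 2 / 2) / l) (Set.Ioi M)) :
    ∃ πt : ℝ → ℝ, (∀ ε ∈ Set.Ioo (0 : ℝ) 1, 0 ≤ πt ε) ∧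
      MeasureTheory.IntegrableOn πt (Set.Ioo (0 : ℝ) 1) ∧
      ∀ x : ℕ → ℝ, (∀ i, -1 ≤ x i) →
        Filter.Tendsto (A2 x) Filter.atTop Filter.atTop →
        (∃ᶠ n in Filter.atTop, Real.sqrt (A2 x n) * ψ (A2 x n) < S x n) →
        Filter.limsup (fun n => ((K πt x n : ℝ) : EReal)) Filter.atTop = ⊤ := by
  obtain ⟨L0, hL0, hψ2⟩ := exists_ge_two M hM ψ hpos hmono hint
  set L := max L0 64 with hLdef
  have hLL0 : L0 ≤ L := le_max_left _ _
  have hL64 : 64 ≤ L := le_max_right _ _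
  have hML : M < L := by linarith
  let g : ℝ → ℝ := fun t => t ^ (1/6 : ℝ)
  have hg6 : ∀ t, 0 ≤ t → g t ^ 6 = t := by
    intro t ht
    simp only [g]
    rw [← Real.rpow_natCast, ← Real.rpow_mul ht]
    norm_num
  have hg2 : ∀ t, L < t → 2 ≤ g t := by
    intro t ht
    have h0 : 0 ≤ g t := Real.rpow_nonneg (by linarith) _
    refine le_of_pow_le_pow_left₀ (n := 6) (by norm_num) h0 ?_
    rw [hg6 t (by linarith)]
    linarith
  have hψge : ∀ t, L < t → 2 ≤ ψ t := fun t ht =>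
    hψ2.trans (hmono hL0 (show M < t by linarith) (by linarith))
  let φ : ℝ → ℝ := fun t => if L < t then min (ψ t) (g t) else 2
  have hφ : ∀ t, L < t → φ t = min (ψ t) (g t) := fun t ht => if_pos ht
  have hφ2 : ∀ t, 2 ≤ φ t := by
    intro t
    by_cases ht : L < t
    · rw [hφ t ht]; exact le_min (hψge t ht) (hg2 t ht)
    · simp [φ, ht]
  have hφm : Monotone φ := by
    intro s t hst
    by_cases hs : L < s
    · have ht : L < t := by linarith
      rw [hφ s hs, hφ t ht]
      apply min_le_min
      · exact hmono (show M < s by linarith) (show M < t by linarith) hst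
      · exact Real.rpow_le_rpow (by linarith) hst (by norm_num)
    · have : φ s = 2 := if_neg hs
      rw [this]; exact hφ2 t
  have hφ6 : ∀ t, L < t → φ t ^ 6 ≤ t := by
    intro t ht
    calc φ t ^ 6 ≤ g t ^ 6 := by
          gcongr
          · linarith [hφ2 t]
          · rw [hφ t ht]; exact min_le_right _ _
      _ = t := hg6 t (by linarith)
  have hφint : IntegrableOn (fun l => φ l * Real.exp (-(φ l) ^ 2 / 2) / l) (Ioi L) := by
    have i1 := hint.mono_set (Ioi_subset_Ioi hML.le)
    have i2 : IntegrableOn (fun t : ℝ => 384 * t ^ (-2 : ℝ)) (Ioi L) :=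
      (integrableOn_Ioi_rpow_of_lt (by norm_num) (by linarith)).const_mul _
    have hφme : Measurable φ := hφm.measurable
    refine Integrable.mono' (i1.add i2) (Measurable.aestronglyMeasurable (by fun_prop)) ?_
    filter_upwards [ae_restrict_mem measurableSet_Ioi] with l hl
    have hl' : L < l := hl
    have hl0 : 0 < l := by linarith
    have hp := hφ2 l
    have hp2 := hψge l hl'
    have hp3 := hg2 l hl'
    rw [Real.norm_of_nonneg (by positivity)]
    simp only [Pi.add_apply]
    rcases min_choice (ψ l) (g l) with h | h
    · rw [hφ l hl', h]
      have : 0 ≤ 384 * l ^ (-2 : ℝ) := by positivity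
      linarith
    · rw [hφ l hl', h]
      have h1 : 0 ≤ ψ l * Real.exp (-(ψ l) ^ 2 / 2) / l := by positivity
      have h2 := f_tail (g l) (by linarith)
      rw [hg6 l hl0.le] at h2
      have h3 : g l * Real.exp (-(g l)^2/2) / l ≤ 384 * l ^ (-2 : ℝ) := by
        calc _ ≤ 384 / l / l := by gcongr
          _ = _ := by
            rw [Real.rpow_neg hl0.le]
            norm_num
            field_simp
      linarith
  obtain ⟨πt, h1, h2, h3⟩ := core φ L hφm hφ2 (by linarith) hφ6 hφint
  refine ⟨πt, h1, h2, fun x hx hA hf => h3 x hx hA ?_⟩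
  refine (hf.and_eventually (hA.eventually_gt_atTop L)).mono ?_
  rintro n ⟨hn, hn2⟩
  refine lt_of_le_of_lt ?_ hn
  gcongr
  rw [hφ _ hn2]
  exact min_le_left _ _
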